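/- The projective Clifford orbit of the Strange state |𝕊⟩ = (|1⟩ − |2⟩)/√2 consists, up to global phase, of exactly the 9 states (|a⟩ − ω^c|b⟩)/√2 indexed by the 3 unordered two-element subsets {a,b} ⊂ 𝔽₃ and the 3 phase exponents c ∈ 𝔽₃: every orbit element is a global-phase multiple of one of these 9 states, each of these 9 states lies in the orbit, and no two of them are global-phase multiples of each other. -/

import Mathlib

open Complex
open scoped BigOperators

noncomputable section

/-- The primitive cube root of unity `ω = exp(2πi/3)`. -/
def ω : ℂ := Complex.exp (2 * Real.pi * Complex.I / 3)

/-- `ω` raised to an exponent in `ZMod 3`. -/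
def ωp (a : ZMod 3) : ℂ := ω ^ a.val

/-- The qutrit Pauli shift gate `X|j⟩ = |j+1⟩`. -/
def Xg : Matrix (ZMod 3) (ZMod 3) ℂ := fun j k => if j = k + 1 then 1 else 0

/-- The qutrit Pauli clock gate `Z|j⟩ = ω^j|j⟩`. -/
def Zg : Matrix (ZMod 3) (ZMod 3) ℂ := fun j k => if j = k then ωp j else 0

/-- The qutrit phase gate `P = diag(1, 1, ω)`. -/
def Pg : Matrix (ZMod 3) (ZMod 3) ℂ :=
  fun j k => if j = k then (if j = 2 then ω else 1) else 0

/-- The qutrit Hadamard gate `H_{jk} = ω^{jk}/√3`. -/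
def Hg : Matrix (ZMod 3) (ZMod 3) ℂ := fun j k => ωp (j * k) / (Real.sqrt 3 : ℂ)

/-- Membership in the single-qutrit Clifford group: the subgroup of unitaries generated by
`X, Z, P, H`, realized as the monoid generated by the (unitary) generators together with
their inverses (= conjugate transposes). -/
def InClifford (U : Matrix (ZMod 3) (ZMod 3) ℂ) : Prop :=
  U ∈ Submonoid.closure
    {Xg, Zg, Pg, Hg, Xg.conjTranspose, Zg.conjTranspose, Pg.conjTranspose, Hg.conjTranspose}

/-- The projective Clifford orbit `{e^{iθ}·U·ψ : U Clifford, θ ∈ ℝ}` of a state `ψ`. -/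
def CliffOrbit (ψ : ZMod 3 → ℂ) : Set (ZMod 3 → ℂ) :=
  {φ | ∃ U, InClifford U ∧ ∃ θ : ℝ, φ = Complex.exp (θ * Complex.I) • U.mulVec ψ}

/-- The two-support equal-modulus state `(|a⟩ - ω^c|b⟩)/√2`. -/
def st (a b c : ZMod 3) : ZMod 3 → ℂ := fun j =>
  ((if j = a then 1 else 0) - ωp c * (if j = b then 1 else 0)) / (Real.sqrt 2 : ℂ)

/-- The Strange state `|𝕊⟩ = (|1⟩ - |2⟩)/√2 = st 1 2 0`. -/
def Strange : ZMod 3 → ℂ := st 1 2 0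

theorem isPrimitiveRoot_ω : IsPrimitiveRoot ω 3 := by
  simpa [ω] using Complex.isPrimitiveRoot_exp 3 (by norm_num)

theorem ωp_zero : ωp 0 = 1 := by simp [ωp]

theorem ωp_add (a b : ZMod 3) : ωp (a + b) = ωp a * ωp b := by
  unfold ωp
  rw [ZMod.val_add, ← pow_add]
  exact (pow_eq_pow_mod _ isPrimitiveRoot_ω.pow_eq_one).symm

theorem ωp_mul_neg (a : ZMod 3) : ωp a * ωp (-a) = 1 := by
  rw [← ωp_add, add_neg_cancel, ωp_zero]

theorem norm_ωp (a : ZMod 3) : ‖ωp a‖ = 1 := by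
  simp [ωp, isPrimitiveRoot_ω.norm'_eq_one (by norm_num)]

theorem ωp_ne_zero (a : ZMod 3) : ωp a ≠ 0 := by
  rw [← norm_ne_zero_iff, norm_ωp]
  exact one_ne_zero

theorem star_ωp (a : ZMod 3) : star (ωp a) = ωp (-a) := by
  have h : (ωp a)⁻¹ = star (ωp a) := Complex.inv_eq_conj (norm_ωp a)
  rw [← h, inv_eq_of_mul_eq_one_right (ωp_mul_neg a)]

theorem ωp_injective : Function.Injective ωp := fun a b h =>
  ZMod.val_injective 3 (isPrimitiveRoot_ω.pow_inj (ZMod.val_lt a) (ZMod.val_lt b) h)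

theorem ωp_add_ωp_neg {d : ZMod 3} (hd : d ≠ 0) : ωp d + ωp (-d) = -1 := by
  have h : 1 + ω + ω ^ 2 = 0 := by
    simpa [Finset.sum_range_succ] using isPrimitiveRoot_ω.geom_sum_eq_zero (by norm_num)
  have h1 : ωp 1 = ω := pow_one ω
  have h2 : ωp 2 = ω ^ 2 := rfl
  obtain rfl | rfl : d = 1 ∨ d = 2 := by revert d; decide
  · rw [show (-1 : ZMod 3) = 2 from rfl, h1, h2]
    linear_combination h
  · rw [show (-2 : ZMod 3) = 1 from rfl, h1, h2]
    linear_combination h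

theorem norm_ωp_sub_ωp_div {a b : ZMod 3} (hab : a ≠ b) :
    ‖(ωp a - ωp b) / (Real.sqrt 3 : ℂ)‖ = 1 := by
  have h : (ωp a - ωp b) * star (ωp a - ωp b) = 3 := by
    have hd := ωp_add_ωp_neg (sub_ne_zero.mpr hab)
    rw [neg_sub, sub_eq_add_neg, sub_eq_add_neg, ωp_add, ωp_add] at hd
    rw [star_sub, star_ωp, star_ωp]
    linear_combination ωp_mul_neg a + ωp_mul_neg b - hd
  have h3 : ‖ωp a - ωp b‖ ^ 2 = 3 := by
    have := congrArg norm h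
    rw [norm_mul, norm_star] at this
    rw [sq, this]
    norm_num
  rw [norm_div, Complex.norm_real, Real.norm_of_nonneg (Real.sqrt_nonneg 3), ← h3,
    Real.sqrt_sq (norm_nonneg _), div_self]
  intro h0
  simp [h0] at h3

theorem sqrt_two_ne_zero : (Real.sqrt 2 : ℂ) ≠ 0 := by
  simp

theorem mulVec_st (U : Matrix (ZMod 3) (ZMod 3) ℂ) (a b c i : ZMod 3) :
    U.mulVec (st a b c) i = (U i a - ωp c * U i b) / (Real.sqrt 2 : ℂ) := by
  have h : st a b c =
      (Real.sqrt 2 : ℂ)⁻¹ • (Pi.single a 1 - ωp c • Pi.single b 1 : ZMod 3 → ℂ) := by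
    ext j
    simp only [st, Pi.smul_apply, Pi.sub_apply, Pi.single_apply, smul_eq_mul]
    ring
  rw [h, Matrix.mulVec_smul, Matrix.mulVec_sub, Matrix.mulVec_smul]
  simp only [Matrix.mulVec_single_one, Pi.smul_apply, Pi.sub_apply, smul_eq_mul, Matrix.col_apply]
  ring

theorem st_swap (a b c : ZMod 3) : st b a c = (-ωp c) • st a b (-c) := by
  ext j
  simp only [st, Pi.smul_apply, smul_eq_mul]
  linear_combination (-(if j = b then 1 else 0) / (Real.sqrt 2 : ℂ)) * ωp_mul_neg c

theorem shift_mulVec_st {U : Matrix (ZMod 3) (ZMod 3) ℂ} {t : ZMod 3}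
    (hU : ∀ j k, U j k = if j = k + t then 1 else 0) (a b c : ZMod 3) :
    U.mulVec (st a b c) = st (a + t) (b + t) c := by
  ext i
  rw [mulVec_st, hU, hU, st]

theorem diagonal_mulVec_st {U : Matrix (ZMod 3) (ZMod 3) ℂ} {f : ZMod 3 → ZMod 3}
    (hU : ∀ j k, U j k = if j = k then ωp (f j) else 0) (a b c : ZMod 3) :
    U.mulVec (st a b c) = ωp (f a) • st a b (c + f b - f a) := by
  ext i
  rw [mulVec_st, hU, hU, Pi.smul_apply, st, smul_eq_mul, sub_eq_add_neg (c + f b), ωp_add, ωp_add]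
  have h := ωp_mul_neg (f a)
  have ha : (if i = a then ωp (f i) else 0) = ωp (f a) * if i = a then 1 else 0 := by
    split_ifs with hi <;> simp [hi]
  have hb : (if i = b then ωp (f i) else 0) = ωp (f b) * if i = b then 1 else 0 := by
    split_ifs with hi <;> simp [hi]
  rw [ha, hb]
  linear_combination (ωp c * ωp (f b) * (if i = b then 1 else 0) / (Real.sqrt 2 : ℂ)) * h

theorem Hg_mulVec_st {a b : ZMod 3} (hab : a ≠ b) (c : ZMod 3) :
    Hg.mulVec (st a b c) =
      (ωp (c * (a - b) * a) * ((ωp a - ωp b) / (Real.sqrt 3 : ℂ))) •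
        st (c * (a - b) + 1) (c * (a - b) - 1) (-a - b) := by
  have hsq : (a - b) * (a - b) = 1 := by revert a b; decide
  obtain ⟨j₀, hj₀⟩ : ∃ j₀, j₀ = c * (a - b) := ⟨_, rfl⟩
  have hc : c = j₀ * (a - b) := by rw [hj₀, mul_assoc, hsq, mul_one]
  ext i
  rw [mulVec_st, ← hj₀, Pi.smul_apply, smul_eq_mul]
  obtain ⟨k, rfl⟩ : ∃ k, i = j₀ + k := ⟨i - j₀, by ring⟩
  have key : ωp ((j₀ + k) * a) - ωp c * ωp ((j₀ + k) * b) =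
      ωp (j₀ * a) * (ωp (k * a) - ωp (k * b)) := by
    rw [mul_sub, ← ωp_add, ← ωp_add, ← ωp_add, hc]
    ring_nf
  have key' : Hg (j₀ + k) a - ωp c * Hg (j₀ + k) b =
      ωp (j₀ * a) * (ωp (k * a) - ωp (k * b)) / (Real.sqrt 3 : ℂ) := by
    rw [← key, Hg, Hg]
    ring
  rw [key', st]
  simp only [sub_eq_add_neg, add_right_inj]
  obtain rfl | rfl | rfl : k = 0 ∨ k = 1 ∨ k = -1 := by
    clear key key'
    revert k
    decide
  · rw [if_neg (by decide), if_neg (by decide)]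
    simp
  · rw [if_pos rfl, if_neg (by decide)]
    simp only [one_mul]
    ring
  · rw [if_neg (by decide), if_pos rfl, ωp_add]
    simp only [neg_mul, one_mul]
    linear_combination (ωp (j₀ * a) / (Real.sqrt 3 : ℂ) / (Real.sqrt 2 : ℂ)) *
      (ωp (-b) * ωp_mul_neg a - ωp (-a) * ωp_mul_neg b)

theorem Hg_conjTranspose_mulVec_st (a b c : ZMod 3) :
    Hg.conjTranspose.mulVec (st a b c) = Hg.mulVec (st (-a) (-b) c) := by
  have h : ∀ i k, Hg.conjTranspose i k = Hg i (-k) := fun i k => by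
    have hs : star (Real.sqrt 3 : ℂ) = (Real.sqrt 3 : ℂ) := Complex.conj_ofReal _
    rw [Matrix.conjTranspose_apply, Hg, Hg, star_div₀, star_ωp, hs, mul_neg, mul_comm k i]
  ext i
  rw [mulVec_st, mulVec_st, h, h]

/-- Unit-modulus multiples of the states `(|a⟩ - ω^c|b⟩)/√2` with `a ≠ b`. -/
def phasedStates : Set (ZMod 3 → ℂ) :=
  {φ | ∃ (a b c : ZMod 3) (u : ℂ), a ≠ b ∧ ‖u‖ = 1 ∧ φ = u • st a b c}

theorem smul_st_mem_phasedStates {a b : ZMod 3} (hab : a ≠ b) (c : ZMod 3) {u : ℂ}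
    (hu : ‖u‖ = 1) : u • st a b c ∈ phasedStates :=
  ⟨a, b, c, u, hab, hu, rfl⟩

theorem smul_mem_phasedStates {φ : ZMod 3 → ℂ} (hφ : φ ∈ phasedStates) {u : ℂ} (hu : ‖u‖ = 1) :
    u • φ ∈ phasedStates := by
  obtain ⟨a, b, c, v, hab, hv, rfl⟩ := hφ
  rw [smul_smul]
  exact smul_st_mem_phasedStates hab c (by rw [norm_mul, hu, hv, one_mul])

theorem exists_lt_of_mem_phasedStates {φ : ZMod 3 → ℂ} (hφ : φ ∈ phasedStates) :
    ∃ (a b c : ZMod 3) (θ : ℝ), a.val < b.val ∧ φ = Complex.exp (θ * Complex.I) • st a b c := by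
  obtain ⟨a, b, c, u, hab, hu, rfl⟩ := hφ
  rcases lt_or_gt_of_ne ((ZMod.val_injective 3).ne hab) with h | h
  · obtain ⟨θ, rfl⟩ := (Complex.norm_eq_one_iff u).mp hu
    exact ⟨a, b, c, θ, h, rfl⟩
  · obtain ⟨θ, hθ⟩ := (Complex.norm_eq_one_iff (u * -ωp c)).mp (by simp [hu, norm_ωp])
    exact ⟨b, a, -c, θ, h, by rw [hθ, st_swap, smul_smul]⟩

theorem shift_mulVec_mem {U : Matrix (ZMod 3) (ZMod 3) ℂ} {t : ZMod 3}
    (hU : ∀ j k, U j k = if j = k + t then 1 else 0) {a b : ZMod 3} (hab : a ≠ b) (c : ZMod 3) :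
    U.mulVec (st a b c) ∈ phasedStates := by
  rw [shift_mulVec_st hU, ← one_smul ℂ (st _ _ _)]
  exact smul_st_mem_phasedStates (by simpa using hab) c norm_one

theorem diagonal_mulVec_mem {U : Matrix (ZMod 3) (ZMod 3) ℂ} {f : ZMod 3 → ZMod 3}
    (hU : ∀ j k, U j k = if j = k then ωp (f j) else 0) {a b : ZMod 3} (hab : a ≠ b)
    (c : ZMod 3) : U.mulVec (st a b c) ∈ phasedStates := by
  rw [diagonal_mulVec_st hU]
  exact smul_st_mem_phasedStates hab _ (norm_ωp _)

theorem Hg_mulVec_mem {a b : ZMod 3} (hab : a ≠ b) (c : ZMod 3) :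
    Hg.mulVec (st a b c) ∈ phasedStates := by
  rw [Hg_mulVec_st hab]
  refine smul_st_mem_phasedStates ?_ _ ?_
  · generalize c * (a - b) = j
    revert j
    decide
  · rw [norm_mul, norm_ωp, norm_ωp_sub_ωp_div hab, one_mul]

theorem conjTranspose_diagonal_apply {U : Matrix (ZMod 3) (ZMod 3) ℂ} {f : ZMod 3 → ZMod 3}
    (hU : ∀ j k, U j k = if j = k then ωp (f j) else 0) (j k : ZMod 3) :
    U.conjTranspose j k = if j = k then ωp (-f j) else 0 := by
  rw [Matrix.conjTranspose_apply, hU]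
  by_cases h : j = k
  · simp only [h, if_true, star_ωp]
  · simp [h, Ne.symm h]

theorem Xg_conjTranspose_apply (j k : ZMod 3) :
    Xg.conjTranspose j k = if j = k + -1 then 1 else 0 := by
  have h : k = j + 1 ↔ j = k + -1 := by revert j k; decide
  rw [Matrix.conjTranspose_apply, Xg]
  simp only [h]
  split_ifs <;> simp

theorem Pg_apply (j k : ZMod 3) :
    Pg j k = if j = k then ωp (if j = 2 then 1 else 0) else 0 := by
  have h1 : ωp 1 = ω := pow_one ω
  rw [Pg]
  split_ifs <;> simp [h1, ωp_zero]

theorem InClifford.mulVec_mem_phasedStates {U : Matrix (ZMod 3) (ZMod 3) ℂ} (hU : InClifford U) :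
    ∀ φ ∈ phasedStates, U.mulVec φ ∈ phasedStates := by
  induction hU using Submonoid.closure_induction with
  | mem V hV =>
    rintro _ ⟨a, b, c, u, hab, hu, rfl⟩
    rw [Matrix.mulVec_smul]
    refine smul_mem_phasedStates ?_ hu
    rcases hV with rfl | rfl | rfl | rfl | rfl | rfl | rfl | rfl
    · exact shift_mulVec_mem (fun _ _ => rfl) hab c
    · exact diagonal_mulVec_mem (f := id) (fun _ _ => rfl) hab c
    · exact diagonal_mulVec_mem Pg_apply hab c
    · exact Hg_mulVec_mem hab c
    · exact shift_mulVec_mem Xg_conjTranspose_apply hab c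
    · exact diagonal_mulVec_mem (conjTranspose_diagonal_apply (f := id) fun _ _ => rfl) hab c
    · exact diagonal_mulVec_mem (conjTranspose_diagonal_apply Pg_apply) hab c
    · rw [Hg_conjTranspose_mulVec_st]
      exact Hg_mulVec_mem (neg_injective.ne hab) c
  | one => simp
  | mul V W _ _ hV hW =>
    intro φ hφ
    rw [← Matrix.mulVec_mulVec]
    exact hV _ (hW _ hφ)

theorem mulVec_mem_CliffOrbit {ψ φ : ZMod 3 → ℂ} {U : Matrix (ZMod 3) (ZMod 3) ℂ}
    (hU : InClifford U) (hφ : φ ∈ CliffOrbit ψ) : U.mulVec φ ∈ CliffOrbit ψ := by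
  obtain ⟨V, hV, θ, rfl⟩ := hφ
  exact ⟨U * V, Submonoid.mul_mem _ hU hV, θ, by rw [Matrix.mulVec_smul, Matrix.mulVec_mulVec]⟩

theorem mem_CliffOrbit_of_smul_mem {ψ φ : ZMod 3 → ℂ} {u : ℂ} (hu : ‖u‖ = 1)
    (hφ : u • φ ∈ CliffOrbit ψ) : φ ∈ CliffOrbit ψ := by
  obtain ⟨V, hV, θ, h⟩ := hφ
  obtain ⟨η, rfl⟩ := (Complex.norm_eq_one_iff u).mp hu
  refine ⟨V, hV, θ - η, ?_⟩
  rw [← inv_smul_smul₀ (Complex.exp_ne_zero (η * Complex.I)) φ, h, smul_smul, ← Complex.exp_neg,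
    ← Complex.exp_add]
  congr 2
  push_cast
  ring

theorem st_add_one_mem_CliffOrbit (a c : ZMod 3) : st a (a + 1) c ∈ CliffOrbit Strange := by
  have hX : ∀ a, st a (a + 1) 0 ∈ CliffOrbit Strange →
      st (a + 1) (a + 1 + 1) 0 ∈ CliffOrbit Strange := by
    intro a h
    rw [← shift_mulVec_st (U := Xg) fun _ _ => rfl]
    exact mulVec_mem_CliffOrbit (Submonoid.subset_closure (by simp)) h
  have hZ : ∀ c, st a (a + 1) c ∈ CliffOrbit Strange →
      st a (a + 1) (c + 1) ∈ CliffOrbit Strange := by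
    intro c h
    refine mem_CliffOrbit_of_smul_mem (norm_ωp a) ?_
    have := diagonal_mulVec_st (U := Zg) (f := id) (fun _ _ => rfl) a (a + 1) c
    rw [show c + id (a + 1) - id a = c + 1 by simp only [id]; ring] at this
    rw [id] at this
    rw [← this]
    exact mulVec_mem_CliffOrbit (Submonoid.subset_closure (by simp)) h
  have h1 : st 1 (1 + 1) 0 ∈ CliffOrbit Strange :=
    ⟨1, Submonoid.one_mem _, 0, by simp [Strange, one_add_one_eq_two]⟩
  have h0 : st a (a + 1) 0 ∈ CliffOrbit Strange := by
    obtain rfl | rfl | rfl : a = 1 ∨ a = 1 + 1 ∨ a = 1 + 1 + 1 := by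
      clear hZ
      revert a
      decide
    exacts [h1, hX _ h1, hX _ (hX _ h1)]
  obtain rfl | rfl | rfl : c = 0 ∨ c = 0 + 1 ∨ c = 0 + 1 + 1 := by revert c; decide
  exacts [h0, hZ _ h0, hZ _ (hZ _ h0)]

theorem st_mem_CliffOrbit {a b : ZMod 3} (hab : a ≠ b) (c : ZMod 3) :
    st a b c ∈ CliffOrbit Strange := by
  obtain rfl | rfl : b = a + 1 ∨ a = b + 1 := by revert a b; decide
  · exact st_add_one_mem_CliffOrbit a c
  · refine mem_CliffOrbit_of_smul_mem (u := -ωp (-c)) (by simp [norm_ωp]) ?_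
    have h := st_swap (b + 1) b (-c)
    rw [neg_neg] at h
    rw [← h]
    exact st_add_one_mem_CliffOrbit b (-c)

theorem st_apply_left {a b : ZMod 3} (hab : a ≠ b) (c : ZMod 3) :
    st a b c a = 1 / (Real.sqrt 2 : ℂ) := by
  simp [st, hab]

theorem st_apply_right {a b : ZMod 3} (hab : a ≠ b) (c : ZMod 3) :
    st a b c b = -ωp c / (Real.sqrt 2 : ℂ) := by
  simp [st, hab.symm]

theorem st_apply_ne_zero_iff {a b : ZMod 3} (hab : a ≠ b) (c j : ZMod 3) :
    st a b c j ≠ 0 ↔ j = a ∨ j = b := by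
  by_cases ha : j = a
  · subst ha
    simp [st_apply_left hab]
  by_cases hb : j = b
  · subst hb
    simp [st_apply_right hab, ωp_ne_zero]
  simp [st, ha, hb]

theorem eq_of_st_eq_smul_st {a b c a' b' c' : ZMod 3} (hab : a.val < b.val)
    (hab' : a'.val < b'.val) {u : ℂ} (hu : u ≠ 0) (h : st a b c = u • st a' b' c') :
    a = a' ∧ b = b' ∧ c = c' := by
  have hne : a ≠ b := fun e => by simp [e] at hab
  have hne' : a' ≠ b' := fun e => by simp [e] at hab'
  have hsupp : ∀ j, (j = a ∨ j = b) ↔ (j = a' ∨ j = b') := fun j => by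
    rw [← st_apply_ne_zero_iff hne c, ← st_apply_ne_zero_iff hne' c', h, Pi.smul_apply,
      smul_ne_zero_iff]
    exact and_iff_right hu
  obtain ⟨rfl, rfl⟩ : a = a' ∧ b = b' := by
    clear h hne hne'
    revert a b a' b'
    decide
  have hl := congrFun h a
  have hr := congrFun h b
  rw [Pi.smul_apply, st_apply_left hne, st_apply_left hne, smul_eq_mul] at hl
  rw [Pi.smul_apply, st_apply_right hne, st_apply_right hne, smul_eq_mul] at hr
  have h2 := sqrt_two_ne_zero
  field_simp at hl hr
  subst hl
  exact ⟨rfl, rfl, ωp_injective (by simpa using hr)⟩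

/-- the projective Clifford orbit of `|𝕊⟩` consists, up to global phase, of
exactly the 9 states `(|a⟩ - ω^c|b⟩)/√2` indexed by the 3 unordered two-element supports
`{a, b} ⊂ 𝔽₃` (represented by `a.val < b.val`) and the 3 phase exponents `c ∈ 𝔽₃`:
every orbit element is a global-phase multiple of one of them, each lies in the orbit,
and no two of them are global-phase multiples of each other. -/
theorem strange_orbit_nine_states :
    (∀ φ ∈ CliffOrbit Strange, ∃ (a b c : ZMod 3) (θ : ℝ),
        a.val < b.val ∧ φ = Complex.exp (θ * Complex.I) • st a b c) ∧
    (∀ a b c : ZMod 3, a.val < b.val → st a b c ∈ CliffOrbit Strange) ∧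
    (∀ a b c a' b' c' : ZMod 3, a.val < b.val → a'.val < b'.val →
      (∃ θ : ℝ, st a b c = Complex.exp (θ * Complex.I) • st a' b' c') →
      a = a' ∧ b = b' ∧ c = c') := by
  refine ⟨?_, ?_, ?_⟩
  · rintro _ ⟨U, hU, θ, rfl⟩
    refine exists_lt_of_mem_phasedStates
      (smul_mem_phasedStates (hU.mulVec_mem_phasedStates _ ?_) (Complex.norm_exp_ofReal_mul_I θ))
    rw [Strange, ← one_smul ℂ (st _ _ _)]
    exact smul_st_mem_phasedStates (by decide) 0 norm_one
  · intro a b c hab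
    exact st_mem_CliffOrbit (fun e => by simp [e] at hab) c
  · rintro a b c a' b' c' hab hab' ⟨θ, h⟩
    exact eq_of_st_eq_smul_st hab hab' (Complex.exp_ne_zero _) h
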